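/- arXiv:2309.00515 — 3 statements merged into one kernel-verified Lean document; each statement's English description precedes it below -/
import Mathlib

section
/- Suppose f is lower semicontinuous on A, there exists x̄ ∈ A such that f is bounded from below on D_x̄, A is convex, and f is Gâteaux differentiable on A. Then for every ε > 0 and every x₀ ∈ L(x̄, ε) := {y ∈ D_x̄ : f(y) ≤ inf_{x ∈ D_x̄} f(x) + ε}, there exists x_ε ∈ D_x̄ such that: (i) T_M(x₀, x_ε) ≤ √ε; (ii) f(x_ε) + √ε · T_M(x₀, x_ε) ≤ f(x₀); and (iii) ⟨f'(x_ε), x_ε − y⟩ ≤ √ε · T_M(x_ε, y) for all y ∈ D_x̄. -/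
open Filter Topology Set
open scoped ENNReal

variable {X : Type*} [NormedAddCommGroup X] [NormedSpace ℝ X]

/-- The directional minimal time function `T_M(y,x) = inf {t ≥ 0 | ∃ m ∈ M, x = y + t•m}`,
with values in `[0,∞]` and `inf ∅ = ∞`. -/
noncomputable def minTime (M : Set X) (y x : X) : ℝ≥0∞ :=
  sInf {t : ℝ≥0∞ | ∃ r : ℝ, 0 ≤ r ∧ t = ENNReal.ofReal r ∧ ∃ m ∈ M, x = y + r • m}

/-- The cone generated by `M`: `cone(M) = {t•m | t ≥ 0, m ∈ M}`. -/
def coneOf (M : Set X) : Set X := {p : X | ∃ t : ℝ, 0 ≤ t ∧ ∃ m ∈ M, p = t • m}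

/-- `D_x := A ∩ dom T_M(·,x)`. -/
def Dset (M A : Set X) (x : X) : Set X := A ∩ {y : X | minTime M y x ≠ ⊤}

theorem minTime_of_mem {M : Set X} (hM : M ⊆ Metric.sphere (0 : X) 1) {y x : X}
    (h : x - y ∈ coneOf M) : minTime M y x = ENNReal.ofReal ‖x - y‖ := by
  have key : ∀ r : ℝ, 0 ≤ r → ∀ m ∈ M, x = y + r • m → ‖x - y‖ = r := by
    intro r hr m hm hx
    have h1 : ‖m‖ = 1 := by simpa using hM hm
    rw [hx, add_sub_cancel_left, norm_smul, h1, mul_one, Real.norm_of_nonneg hr]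
  apply le_antisymm
  · obtain ⟨t, ht, m, hm, e⟩ := h
    have hx : x = y + t • m := by rw [← e]; abel
    exact sInf_le ⟨t, ht, by rw [key t ht m hm hx], m, hm, hx⟩
  · refine le_sInf ?_
    rintro t ⟨r, hr, rfl, m, hm, hx⟩
    rw [key r hr m hm hx]

theorem minTime_of_not_mem {M : Set X} {y x : X}
    (h : x - y ∉ coneOf M) : minTime M y x = ⊤ := by
  unfold minTime
  rw [sInf_eq_top]
  rintro t ⟨r, hr, rfl, m, hm, hx⟩
  exact absurd ⟨r, hr, m, hm, by rw [hx]; abel⟩ h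

theorem mem_Dset {M A : Set X} (hM : M ⊆ Metric.sphere (0 : X) 1) {y x : X} :
    y ∈ Dset M A x ↔ y ∈ A ∧ x - y ∈ coneOf M := by
  unfold Dset
  by_cases h : x - y ∈ coneOf M
  · simp [minTime_of_mem hM h, h]
  · simp [minTime_of_not_mem h, h]

theorem coneOf_smul {M : Set X} {p : X} (h : p ∈ coneOf M) {c : ℝ} (hc : 0 ≤ c) :
    c • p ∈ coneOf M := by
  obtain ⟨t, ht, m, hm, rfl⟩ := h
  exact ⟨c * t, mul_nonneg hc ht, m, hm, by rw [smul_smul]⟩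

theorem coneOf_add {M : Set X} (hc : Convex ℝ (coneOf M)) {p q : X} (h : p ∈ coneOf M)
    (h' : q ∈ coneOf M) : p + q ∈ coneOf M := by
  have h1 : (1/2 : ℝ) • p + (1/2 : ℝ) • q ∈ coneOf M :=
    hc h h' (by norm_num) (by norm_num) (by norm_num)
  have h2 := coneOf_smul h1 (c := 2) (by norm_num)
  rwa [smul_add, smul_smul, smul_smul, show (2 * (1/2) : ℝ) = 1 by norm_num, one_smul,
    one_smul] at h2

theorem coneOf_zero {M : Set X} (hne : M.Nonempty) : (0 : X) ∈ coneOf M := by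
  obtain ⟨m, hm⟩ := hne
  exact ⟨0, le_rfl, m, hm, by simp⟩

theorem coneOf_closed {M : Set X} (hne : M.Nonempty) (hcl : IsClosed M)
    (hM : M ⊆ Metric.sphere (0 : X) 1) : IsClosed (coneOf M) := by
  refine isClosed_of_closure_subset fun p hp => ?_
  by_cases h0 : p = 0
  · rw [h0]; exact coneOf_zero hne
  have hfr := mem_closure_iff_frequently.1 hp
  have hev : ∀ᶠ q in 𝓝 p, q ≠ 0 := isOpen_ne.mem_nhds h0
  have hcont : Tendsto (fun q : X => ‖q‖⁻¹ • q) (𝓝 p) (𝓝 (‖p‖⁻¹ • p)) := by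
    have : ContinuousAt (fun q : X => ‖q‖⁻¹ • q) p :=
      (continuous_norm.continuousAt.inv₀ (norm_ne_zero_iff.2 h0)).smul continuousAt_id
    exact this
  have hfr2 : ∃ᶠ q in 𝓝 p, ‖q‖⁻¹ • q ∈ M := by
    refine (hfr.and_eventually hev).mono ?_
    rintro q ⟨⟨t, ht, m, hm, rfl⟩, hq⟩
    have h1 : ‖m‖ = 1 := by simpa using hM hm
    have ht0 : t ≠ 0 := by rintro rfl; simp at hq
    rw [norm_smul, h1, mul_one, Real.norm_of_nonneg ht, smul_smul, inv_mul_cancel₀ ht0, one_smul]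
    exact hm
  have hmem : ‖p‖⁻¹ • p ∈ M := by
    rw [← hcl.closure_eq]
    exact mem_closure_iff_frequently.2 (hcont.frequently hfr2)
  exact ⟨‖p‖, norm_nonneg _, _, hmem, by
    rw [smul_smul, mul_inv_cancel₀ (norm_ne_zero_iff.2 h0), one_smul]⟩

theorem ekeland_abstract {Y : Type*} [MetricSpace Y] [CompleteSpace Y] (D : Set Y) (f : Y → ℝ)
    (b : ℝ) (hb : ∀ x ∈ D, b ≤ f x) (c : ℝ) (hc : 0 < c) (S : Y → Set Y)
    (hSD : ∀ x ∈ D, S x ⊆ D) (hcl : ∀ x ∈ D, IsClosed (S x)) (hrefl : ∀ x ∈ D, x ∈ S x)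
    (htr : ∀ x ∈ D, ∀ y ∈ S x, S y ⊆ S x)
    (hd : ∀ x ∈ D, ∀ y ∈ S x, f y + c * dist x y ≤ f x) (x0 : Y) (hx0 : x0 ∈ D) :
    ∃ xe ∈ S x0, ∀ y ∈ S xe, y = xe := by
  have hex : ∀ (n : ℕ) (x : D), ∃ y : D, y.1 ∈ S x ∧ ∀ z ∈ S x, f y ≤ f z + 1 / ((n : ℝ) + 1) := by
    rintro n ⟨x, hx⟩
    have hne : (f '' S x).Nonempty := ⟨_, x, hrefl x hx, rfl⟩
    have hbd : BddBelow (f '' S x) := ⟨b, by rintro _ ⟨z, hz, rfl⟩; exact hb z (hSD x hx hz)⟩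
    obtain ⟨_, ⟨y, hy, rfl⟩, hlt⟩ :=
      exists_lt_of_csInf_lt hne (show sInf (f '' S x) < sInf (f '' S x) + 1 / ((n : ℝ) + 1) from
        lt_add_of_pos_right _ (by positivity))
    refine ⟨⟨y, hSD x hx hy⟩, hy, fun z hz => ?_⟩
    have := csInf_le hbd ⟨z, hz, rfl⟩
    show f y ≤ _
    linarith
  choose g hg1 hg2 using hex
  let u : ℕ → D := fun n => Nat.rec ⟨x0, hx0⟩ (fun n x => g n x) n
  have hu0 : (u 0).1 = x0 := rfl
  have hus : ∀ n, u (n+1) = g n (u n) := fun n => rfl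
  have hanti : ∀ n m, n ≤ m → S (u m).1 ⊆ S (u n).1 := by
    intro n m h
    induction m, h using Nat.le_induction with
    | base => exact le_rfl
    | succ m _ ih =>
      refine subset_trans ?_ ih
      rw [hus]
      exact htr _ (u m).2 _ (hg1 m (u m))
  have hrad : ∀ n, ∀ y ∈ S (u (n+1)).1, dist (u (n+1)).1 y ≤ 1 / ((n : ℝ) + 1) / c := by
    intro n y hy
    have h1 := hd _ (u (n+1)).2 y hy
    have h2 := hg2 n (u n) y (hanti n (n+1) (Nat.le_succ n) hy)
    rw [← hus] at h2
    rw [le_div_iff₀ hc]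
    linarith
  have hlim : Tendsto (fun n : ℕ => 1 / ((n : ℝ) + 1) / c) atTop (𝓝 0) := by
    simpa using tendsto_one_div_add_atTop_nhds_zero_nat.div_const c
  have hmem : ∀ n m : ℕ, n ≤ m → (u m).1 ∈ S (u n).1 := fun n m h => hanti n m h (hrefl _ (u m).2)
  let v : ℕ → Y := fun n => (u (n+1)).1
  have hcau : CauchySeq v := by
    refine cauchySeq_of_le_tendsto_0' (fun n : ℕ => 1 / ((n : ℝ) + 1) / c) ?_ hlim
    intro n m h
    exact hrad n _ (hmem (n+1) (m+1) (by omega))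
  obtain ⟨xe, hxe⟩ := cauchySeq_tendsto_of_complete hcau
  have hin : ∀ n, xe ∈ S (u n).1 := by
    intro n
    refine (hcl _ (u n).2).mem_of_tendsto hxe ?_
    filter_upwards [eventually_ge_atTop n] with m hm
    exact hmem n (m+1) (by omega)
  refine ⟨xe, by simpa [hu0] using hin 0, fun y hy => ?_⟩
  have hy' : Tendsto v atTop (𝓝 y) := by
    rw [tendsto_iff_dist_tendsto_zero]
    refine squeeze_zero (fun _ => dist_nonneg) (fun n => hrad n y ?_) hlim
    exact htr _ (u (n+1)).2 _ (hin (n+1)) hy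
  exact tendsto_nhds_unique hy' hxe

/-- Corollary 3.1, Ekeland principle with Gâteaux differentiability. -/
theorem directional_ekeland_gateaux [CompleteSpace X]
    (M : Set X) (hMne : M.Nonempty) (hMcl : IsClosed M)
    (hMsph : M ⊆ Metric.sphere (0 : X) 1) (hMcone : Convex ℝ (coneOf M))
    (A : Set X) (hAne : A.Nonempty) (hAcl : IsClosed A) (hAconv : Convex ℝ A)
    (f : X → ℝ) (hlsc : LowerSemicontinuousOn f A)
    (f' : X → (X →L[ℝ] ℝ))
    (hgat : ∀ x ∈ A, ∀ d : X,
      Tendsto (fun l : ℝ => (f (x + l • d) - f x) / l) (𝓝[≠] 0) (𝓝 (f' x d)))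
    (xb : X) (hxb : xb ∈ A)
    (hbdd : ∃ b : ℝ, ∀ x ∈ Dset M A xb, b ≤ f x)
    (ε : ℝ) (hε : 0 < ε) (x0 : X) (hx0D : x0 ∈ Dset M A xb)
    (hx0L : f x0 ≤ sInf (f '' Dset M A xb) + ε) :
    ∃ xe ∈ Dset M A xb,
      minTime M x0 xe ≤ ENNReal.ofReal (Real.sqrt ε) ∧
      (f xe : EReal) + ((ENNReal.ofReal (Real.sqrt ε) * minTime M x0 xe : ℝ≥0∞) : EReal)
        ≤ (f x0 : EReal) ∧
      ∀ y ∈ Dset M A xb,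
        ((f' xe (xe - y) : ℝ) : EReal)
          ≤ ((ENNReal.ofReal (Real.sqrt ε) * minTime M xe y : ℝ≥0∞) : EReal) := by
  obtain ⟨b, hb⟩ := hbdd
  have hc : 0 < Real.sqrt ε := Real.sqrt_pos.2 hε
  have hcc : Real.sqrt ε * Real.sqrt ε = ε := Real.mul_self_sqrt hε.le
  set c := Real.sqrt ε with hcdef
  have hK := coneOf_closed hMne hMcl hMsph
  have hcoe : ∀ r : ℝ, 0 ≤ r →
      ((ENNReal.ofReal c * ENNReal.ofReal r : ℝ≥0∞) : EReal) = ((c * r : ℝ) : EReal) := by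
    intro r hr
    rw [← ENNReal.ofReal_mul hc.le, EReal.coe_ennreal_ofReal, max_eq_left (by positivity)]
  let S : X → Set X := fun x => {y | (y ∈ A ∧ f y + c * ‖y - x‖ ≤ f x) ∧
    xb - y ∈ coneOf M ∧ y - x ∈ coneOf M}
  obtain ⟨xe, hxe, hmin⟩ := ekeland_abstract (Dset M A xb) f b hb c hc S
    (fun x hx y hy => (mem_Dset hMsph).2 ⟨hy.1.1, hy.2.1⟩)
    (by
      intro x hx
      refine IsClosed.inter ?_ (IsClosed.inter (hK.preimage (f := fun y => xb - y) (by fun_prop))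
        (hK.preimage (f := fun y => y - x) (by fun_prop)))
      have hl : LowerSemicontinuousOn (fun y => f y + c * ‖y - x‖) A :=
        hlsc.add ((show Continuous (fun y => c * ‖y - x‖) by fun_prop).lowerSemicontinuous.lowerSemicontinuousOn A)
      obtain ⟨v, hv, e⟩ := lowerSemicontinuousOn_iff_preimage_Iic.1 hl (f x)
      have : {y | y ∈ A ∧ f y + c * ‖y - x‖ ≤ f x} = A ∩ v := by rw [← e]; rfl
      have h3 := hAcl.inter hv
      rw [← this] at h3
      exact h3)
    (by
      intro x hx
      have := (mem_Dset hMsph).1 hx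
      exact ⟨⟨this.1, by simp⟩, this.2, by simpa using coneOf_zero hMne⟩)
    (by
      rintro x hx y ⟨⟨hyA, hy1⟩, hy2, hy3⟩ z ⟨⟨hzA, hz1⟩, hz2, hz3⟩
      refine ⟨⟨hzA, ?_⟩, hz2, ?_⟩
      · have := mul_le_mul_of_nonneg_left (norm_sub_le_norm_sub_add_norm_sub z y x) hc.le
        linarith
      · simpa using coneOf_add hMcone hz3 hy3)
    (by
      rintro x hx y ⟨⟨hyA, hy1⟩, hy2, hy3⟩
      rwa [dist_comm, dist_eq_norm])
    x0 hx0D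
  obtain ⟨⟨heA, he1⟩, he2, he3⟩ := hxe
  have heD : xe ∈ Dset M A xb := (mem_Dset hMsph).2 ⟨heA, he2⟩
  refine ⟨xe, heD, ?_, ?_, ?_⟩
  · rw [minTime_of_mem hMsph he3]
    apply ENNReal.ofReal_le_ofReal
    have h1 : sInf (f '' Dset M A xb) ≤ f xe :=
      csInf_le ⟨b, by rintro _ ⟨z, hz, rfl⟩; exact hb z hz⟩ ⟨xe, heD, rfl⟩
    have : c * ‖xe - x0‖ ≤ c * c := by linarith
    exact le_of_mul_le_mul_left this hc
  · rw [minTime_of_mem hMsph he3, hcoe _ (norm_nonneg _), ← EReal.coe_add]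
    exact EReal.coe_le_coe_iff.2 he1
  · intro y hy
    by_cases hk : y - xe ∈ coneOf M
    swap
    · rw [minTime_of_not_mem hk, ENNReal.mul_top (by simpa using hc)]
      simp
    rw [minTime_of_mem hMsph hk, hcoe _ (norm_nonneg _)]
    apply EReal.coe_le_coe_iff.2
    obtain ⟨hyA, hyK⟩ := (mem_Dset hMsph).1 hy
    have ht : Tendsto (fun l : ℝ => (f (xe + l • (y - xe)) - f xe) / l) (𝓝[>] 0)
        (𝓝 (f' xe (y - xe))) :=
      (hgat xe heA (y - xe)).mono_left (nhdsWithin_mono _ fun l hl => ne_of_gt hl)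
    have hge : -(c * ‖y - xe‖) ≤ f' xe (y - xe) := by
      refine ge_of_tendsto ht ?_
      filter_upwards [Ioo_mem_nhdsGT (zero_lt_one (α := ℝ))] with l hl
      rw [le_div_iff₀ hl.1]
      by_contra hcon
      push Not at hcon
      have hn : ‖l • (y - xe)‖ = l * ‖y - xe‖ := by
        rw [norm_smul, Real.norm_of_nonneg hl.1.le]
      have hz : xe + l • (y - xe) ∈ S xe := by
        refine ⟨⟨hAconv.add_smul_sub_mem heA hyA ⟨hl.1.le, hl.2.le⟩, ?_⟩, ?_, ?_⟩
        · rw [add_sub_cancel_left, hn]; nlinarith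
        · have := hMcone he2 hyK (a := 1 - l) (b := l) (by linarith [hl.2]) hl.1.le (by ring)
          convert this using 1
          module
        · rw [add_sub_cancel_left]; exact coneOf_smul hk hl.1.le
      have he := hmin _ hz
      have h0 : l • (y - xe) = 0 := by simpa using he
      rw [he] at hcon
      rw [h0, norm_zero] at hn
      nlinarith
    have : f' xe (xe - y) = - f' xe (y - xe) := by rw [← map_neg, neg_sub]
    linarith
end

section
/- Let X be a reflexive Banach space. Assume A ⊆ X is convex and closed, f is lower semicontinuous, convex and Gâteaux differentiable on A, and f' is continuous on A. For ε > 0 set H(ε) := {x ∈ A : ⟨f'(x), x − y⟩ ≤ ε·T_M(y, x) for all y ∈ D_x}. Then problem (MP) is directionally Tykhonov well-posed with respect to M if and only if there exists x̄ ∈ A such that f is bounded from below on D_x̄, x̄ ∈ ⋂_{ε>0} H(ε), and diam(H'(x̄, ε)) → 0 as ε → 0, where H'(x̄, ε) := {x ∈ D_x̄ : ⟨f'(x), x − y⟩ ≤ ε·T_M(x, y) for all y ∈ D_x̄}. -/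
open Filter Topology Set
open scoped ENNReal

variable {X : Type*} [NormedAddCommGroup X] [NormedSpace ℝ X]

/-- Directional Tykhonov well-posedness of (MP) for a real-valued objective. -/
def DirTykhonovWPReal (M A : Set X) (f : X → ℝ) : Prop :=
  ∃ xb ∈ A, (∀ x ∈ Dset M A xb, f xb ≤ f x) ∧
    (∀ x ∈ Dset M A xb, f x = f xb → x = xb) ∧
    ∀ u : ℕ → X, (∀ k, u k ∈ Dset M A xb) →
      Tendsto (fun k => f (u k)) atTop (𝓝 (f xb)) →
      Tendsto (fun k => minTime M (u k) xb) atTop (𝓝 0)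

lemma aux_ekeland {Y : Type*} [MetricSpace Y] [CompleteSpace Y] (D : Set Y) (hD : IsClosed D)
    (f : Y → ℝ) (hf : LowerSemicontinuousOn f D) (b : ℝ) (hb : ∀ x ∈ D, b ≤ f x)
    (c : ℝ) (hc : 0 < c) (u : Y) (hu : u ∈ D) :
    ∃ v ∈ D, f v + c * dist u v ≤ f u ∧ ∀ y ∈ D, f v ≤ f y + c * dist y v := by
  have step : ∀ (n : ℕ) (x : D), ∃ y : D, f y + c * dist (x : Y) y ≤ f x ∧
      ∀ z ∈ D, f z + c * dist (x : Y) z ≤ f x → f y ≤ f z + 1 / ((n : ℝ) + 1) := by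
    intro n x
    let S : Set ℝ := f '' {z | z ∈ D ∧ f z + c * dist (x : Y) z ≤ f x}
    have hne : S.Nonempty := ⟨f x, x, ⟨x.2, by simp⟩, rfl⟩
    have hbd : BddBelow S := ⟨b, by rintro _ ⟨z, hz, rfl⟩; exact hb z hz.1⟩
    have hpos : (0 : ℝ) < 1 / ((n : ℝ) + 1) := by positivity
    obtain ⟨_, ⟨y, hy, rfl⟩, hlt⟩ := exists_lt_of_csInf_lt hne (lt_add_of_pos_right (sInf S) hpos)
    refine ⟨⟨y, hy.1⟩, hy.2, fun z hz hz2 => ?_⟩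
    have : sInf S ≤ f z := csInf_le hbd ⟨z, ⟨hz, hz2⟩, rfl⟩
    simp only
    linarith
  choose g hg1 hg2 using step
  let x : ℕ → D := fun n => Nat.rec (motive := fun _ => D) ⟨u, hu⟩ (fun n y => g n y) n
  have hx : ∀ n, x (n + 1) = g n (x n) := fun n => rfl
  have hmono : ∀ n m : ℕ, n ≤ m → f (x m) + c * dist (x n : Y) (x m) ≤ f (x n) := by
    intro n m hnm
    induction m, hnm using Nat.le_induction with
    | base => simp
    | succ m hm ih =>
      have h1 := hg1 m (x m)
      rw [← hx] at h1
      have h2 := dist_triangle (x n : Y) (x m) (x (m + 1))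
      nlinarith
  have hanti : Antitone (fun n => f (x n)) := by
    intro n m hnm
    have := hmono n m hnm
    have h2 : 0 ≤ c * dist (x n : Y) (x m) := by positivity
    simp only
    linarith
  have hbdd : BddBelow (range (fun n => f (x n))) :=
    ⟨b, by rintro _ ⟨n, rfl⟩; exact hb _ (x n).2⟩
  have hlim := tendsto_atTop_ciInf hanti hbdd
  set L := ⨅ n, f (x n) with hL
  have hLle : ∀ n, L ≤ f (x n) := fun n => ciInf_le hbdd n
  have hcau : CauchySeq (fun n => (x n : Y)) := by
    refine cauchySeq_of_le_tendsto_0' (fun n => (f (x n) - L) / c) ?_ ?_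
    · intro n m hnm
      rw [le_div_iff₀ hc]
      have := hmono n m hnm
      have := hLle m
      linarith
    · have := (hlim.sub_const L).div_const c
      simpa using this
  obtain ⟨v, hv⟩ := cauchySeq_tendsto_of_complete hcau
  have hvD : v ∈ D := hD.mem_of_tendsto hv (Eventually.of_forall fun n => (x n).2)
  have hvn : ∀ n, f v + c * dist (x n : Y) v ≤ f (x n) := by
    intro n
    suffices f v ≤ f (x n) - c * dist (x n : Y) v by linarith
    refine le_of_forall_lt fun a ha => ?_
    obtain ⟨a', ha1, ha2⟩ := exists_between ha
    refine lt_of_lt_of_le ha1 ?_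
    have hv' : Tendsto (fun n => (x n : Y)) atTop (𝓝[D] v) :=
      tendsto_nhdsWithin_iff.2 ⟨hv, Eventually.of_forall fun n => (x n).2⟩
    have h1 : ∀ᶠ m in atTop, a' < f (x m) := hv'.eventually (hf v hvD a' ha2)
    have h2 : Tendsto (fun m => f (x n) - c * dist (x n : Y) (x m)) atTop
        (𝓝 (f (x n) - c * dist (x n : Y) v)) :=
      ((tendsto_const_nhds.dist hv).const_mul c).const_sub _
    refine ge_of_tendsto h2 ?_
    filter_upwards [h1, eventually_ge_atTop n] with m hm hnm
    have := hmono n m hnm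
    linarith
  refine ⟨v, hvD, hvn 0, fun y hy => ?_⟩
  by_contra! hcon
  have hle : ∀ n : ℕ, f v ≤ f y + 1 / ((n : ℝ) + 1) := by
    intro n
    have h1 := hg2 n (x n) y hy (by
      have h3 := hvn n
      have h4 := dist_triangle (x n : Y) v y
      rw [dist_comm v y] at h4
      nlinarith)
    rw [← hx] at h1
    have h3 := hvn (n + 1)
    have h2 : 0 ≤ c * dist (x (n + 1) : Y) v := by positivity
    linarith
  have h5 : f v ≤ f y := by
    have h6 := (tendsto_one_div_add_atTop_nhds_zero_nat (𝕜 := ℝ)).const_add (f y)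
    rw [add_zero] at h6
    exact ge_of_tendsto' h6 hle
  have h2 : 0 ≤ c * dist y v := by positivity
  linarith

lemma aux_minTime_ne_top (M : Set X) (y x : X) : minTime M y x ≠ ⊤ ↔ x - y ∈ coneOf M := by
  constructor
  · intro h
    have h1 : sInf {t : ℝ≥0∞ | ∃ r : ℝ, 0 ≤ r ∧ t = ENNReal.ofReal r ∧ ∃ m ∈ M, x = y + r • m} < ⊤ :=
      lt_top_iff_ne_top.2 h
    obtain ⟨t, ⟨r, hr, -, m, hm, hx⟩, -⟩ := sInf_lt_iff.1 h1
    exact ⟨r, hr, m, hm, by rw [hx]; abel⟩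
  · rintro ⟨t, ht, m, hm, h⟩
    refine ne_top_of_le_ne_top (ENNReal.ofReal_ne_top (r := t)) (sInf_le ⟨t, ht, rfl, m, hm, ?_⟩)
    rw [← h]; abel

lemma aux_minTime_eq (M : Set X) (hM : M ⊆ Metric.sphere (0 : X) 1) (y x : X)
    (h : x - y ∈ coneOf M) : minTime M y x = ENNReal.ofReal ‖x - y‖ := by
  have key : ∀ r : ℝ, 0 ≤ r → ∀ m ∈ M, x = y + r • m → ‖x - y‖ = r := by
    intro r hr m hm hx
    have : ‖m‖ = 1 := by simpa using hM hm
    rw [hx, add_sub_cancel_left, norm_smul, this, mul_one, Real.norm_of_nonneg hr]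
  apply le_antisymm
  · obtain ⟨t, ht, m, hm, h⟩ := h
    have hx : x = y + t • m := by rw [← h]; abel
    rw [key t ht m hm hx]
    exact sInf_le ⟨t, ht, rfl, m, hm, hx⟩
  · refine le_sInf ?_
    rintro _ ⟨r, hr, rfl, m, hm, hx⟩
    rw [key r hr m hm hx]

lemma aux_mem_Dset (M A : Set X) (x y : X) : y ∈ Dset M A x ↔ y ∈ A ∧ x - y ∈ coneOf M := by
  rw [← aux_minTime_ne_top]; rfl

lemma aux_cone_closed (M : Set X) (hMne : M.Nonempty) (hMcl : IsClosed M)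
    (hM : M ⊆ Metric.sphere (0 : X) 1) : IsClosed (coneOf M) := by
  rw [← isSeqClosed_iff_isClosed]
  intro u p hu hp
  by_cases h0 : p = 0
  · obtain ⟨m, hm⟩ := hMne
    exact ⟨0, le_rfl, m, hm, by simp [h0]⟩
  have hn : ‖p‖ ≠ 0 := norm_ne_zero_iff.2 h0
  refine ⟨‖p‖, norm_nonneg _, ‖p‖⁻¹ • p, ?_, by rw [smul_smul, mul_inv_cancel₀ hn, one_smul]⟩
  have h1 : Tendsto (fun n => ‖u n‖⁻¹ • u n) atTop (𝓝 (‖p‖⁻¹ • p)) := (hp.norm.inv₀ hn).smul hp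
  refine hMcl.mem_of_tendsto h1 ?_
  filter_upwards [hp.eventually_ne h0] with n hne
  obtain ⟨t, ht, m, hm, h⟩ := hu n
  have hm1 : ‖m‖ = 1 := by simpa using hM hm
  have ht0 : t ≠ 0 := by rintro rfl; simp at h; exact hne h
  rw [h, norm_smul, hm1, mul_one, Real.norm_of_nonneg ht, smul_smul, inv_mul_cancel₀ ht0, one_smul]
  exact hm

lemma aux_grad_le (A : Set X) (f : X → ℝ) (hconv : ConvexOn ℝ A f) (x y : X) (hx : x ∈ A)
    (hy : y ∈ A) (g : X →L[ℝ] ℝ)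
    (hg : ∀ d : X, Tendsto (fun l : ℝ => (f (x + l • d) - f x) / l) (𝓝[≠] 0) (𝓝 (g d))) :
    f x - f y ≤ g (x - y) := by
  have h1 : Tendsto (fun l : ℝ => (f (x + l • (y - x)) - f x) / l) (𝓝[>] 0) (𝓝 (g (y - x))) :=
    (hg (y - x)).mono_left (nhdsWithin_mono _ fun l hl => ne_of_gt hl)
  have h2 : g (y - x) ≤ f y - f x := by
    refine le_of_tendsto h1 ?_
    filter_upwards [Ioo_mem_nhdsGT (zero_lt_one (α := ℝ))] with l hl
    rw [div_le_iff₀ hl.1]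
    have := hconv.2 hx hy (sub_nonneg.2 hl.2.le) hl.1.le (by ring)
    have e : (1 - l) • x + l • y = x + l • (y - x) := by module
    rw [e] at this
    simp only [smul_eq_mul] at this
    linarith
  have : g (x - y) = - g (y - x) := by rw [← map_neg, neg_sub]
  linarith

lemma aux_grad_ge (D : Set X) (hD : Convex ℝ D) (f : X → ℝ) (x y : X) (hx : x ∈ D)
    (hy : y ∈ D) (c : ℝ) (h : ∀ z ∈ D, f x ≤ f z + c * ‖z - x‖) (g : X →L[ℝ] ℝ)
    (hg : ∀ d : X, Tendsto (fun l : ℝ => (f (x + l • d) - f x) / l) (𝓝[≠] 0) (𝓝 (g d))) :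
    g (x - y) ≤ c * ‖y - x‖ := by
  have h1 : Tendsto (fun l : ℝ => (f (x + l • (y - x)) - f x) / l) (𝓝[>] 0) (𝓝 (g (y - x))) :=
    (hg (y - x)).mono_left (nhdsWithin_mono _ fun l hl => ne_of_gt hl)
  have h2 : -(c * ‖y - x‖) ≤ g (y - x) := by
    refine ge_of_tendsto h1 ?_
    filter_upwards [Ioo_mem_nhdsGT (zero_lt_one (α := ℝ))] with l hl
    rw [le_div_iff₀ hl.1]
    have hz := h _ (hD.add_smul_sub_mem hx hy ⟨hl.1.le, hl.2.le⟩)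
    rw [add_sub_cancel_left, norm_smul, Real.norm_of_nonneg hl.1.le] at hz
    linarith
  have : g (x - y) = - g (y - x) := by rw [← map_neg, neg_sub]
  linarith

lemma aux_ineq (M : Set X) (hM : M ⊆ Metric.sphere (0 : X) 1) (y x : X) (a ε : ℝ) (hε : 0 < ε) :
    ((a : ℝ) : EReal) ≤ ((ENNReal.ofReal ε * minTime M y x : ℝ≥0∞) : EReal) ↔
      (x - y ∈ coneOf M → a ≤ ε * ‖x - y‖) := by
  by_cases h : x - y ∈ coneOf M
  · rw [aux_minTime_eq M hM y x h, ← ENNReal.ofReal_mul hε.le, EReal.coe_ennreal_ofReal,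
      max_eq_left (by positivity), EReal.coe_le_coe_iff]
    simp [h]
  · have : minTime M y x = ⊤ := by
      by_contra h'
      exact h ((aux_minTime_ne_top M y x).1 h')
    rw [this, ENNReal.mul_top (by simpa using hε)]
    simp [h]

/-- Theorem 3.5: characterization of directional Tykhonov well-posedness
via the sets `H(ε)`, `H'(x̄,ε)` built from the Gâteaux derivative, in a reflexive space. -/
theorem dirTykhonovWP_iff_H [CompleteSpace X]
    (hrefl : Function.Surjective ⇑(NormedSpace.inclusionInDoubleDual ℝ X))
    (M : Set X) (hMne : M.Nonempty) (hMcl : IsClosed M)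
    (hMsph : M ⊆ Metric.sphere (0 : X) 1) (hMcone : Convex ℝ (coneOf M))
    (A : Set X) (hAne : A.Nonempty) (hAcl : IsClosed A) (hAconv : Convex ℝ A)
    (f : X → ℝ) (hlsc : LowerSemicontinuousOn f A) (hconv : ConvexOn ℝ A f)
    (f' : X → (X →L[ℝ] ℝ))
    (hgat : ∀ x ∈ A, ∀ d : X,
      Tendsto (fun l : ℝ => (f (x + l • d) - f x) / l) (𝓝[≠] 0) (𝓝 (f' x d)))
    (hf'cont : ContinuousOn f' A) :
    DirTykhonovWPReal M A f ↔
      ∃ xb ∈ A,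
        (∃ b : ℝ, ∀ x ∈ Dset M A xb, b ≤ f x) ∧
        (∀ ε : ℝ, 0 < ε → xb ∈ {x ∈ A | ∀ y ∈ Dset M A x,
            ((f' x (x - y) : ℝ) : EReal)
              ≤ ((ENNReal.ofReal ε * minTime M y x : ℝ≥0∞) : EReal)}) ∧
        Tendsto (fun ε : ℝ =>
            EMetric.diam {x ∈ Dset M A xb | ∀ y ∈ Dset M A xb,
              ((f' x (x - y) : ℝ) : EReal)
                ≤ ((ENNReal.ofReal ε * minTime M x y : ℝ≥0∞) : EReal)})
          (𝓝[>] 0) (𝓝 0) := by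
  have hKcl := aux_cone_closed M hMne hMcl hMsph
  have hDcl : ∀ x, IsClosed (Dset M A x) := by
    intro x
    have : Dset M A x = A ∩ (fun y => x - y) ⁻¹' coneOf M := by
      ext y; rw [aux_mem_Dset]; rfl
    rw [this]
    exact hAcl.inter (hKcl.preimage (by fun_prop))
  have hDconv : ∀ x, Convex ℝ (Dset M A x) := by
    intro x y hy z hz a b ha hb hab
    rw [aux_mem_Dset] at *
    refine ⟨hAconv hy.1 hz.1 ha hb hab, ?_⟩
    have := hMcone hy.2 hz.2 ha hb hab
    convert this using 1
    have : x = (a + b) • x := by rw [hab, one_smul]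
    nth_rw 1 [this]
    module
  have hDA : ∀ x, Dset M A x ⊆ A := fun x => inter_subset_left
  have hself : ∀ x ∈ A, x ∈ Dset M A x := by
    intro x hx
    obtain ⟨m, hm⟩ := hMne
    exact (aux_mem_Dset M A x x).2 ⟨hx, 0, le_rfl, m, hm, by simp⟩
  constructor
  · rintro ⟨xb, hxb, hmin, huniq, hseq⟩
    refine ⟨xb, hxb, ⟨f xb, hmin⟩, ?_, ?_⟩
    · intro ε hε
      refine ⟨hxb, fun y hy => (aux_ineq M hMsph y xb _ ε hε).2 fun hc => ?_⟩
      have := aux_grad_ge _ (hDconv xb) f xb y (hself xb hxb) hy 0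
        (fun z hz => by simpa using hmin z hz) (f' xb) (hgat xb hxb)
      rw [zero_mul] at this
      exact this.trans (by positivity)
    · -- growth
      have hgrow : ∀ r : ℝ, 0 < r → ∃ c > 0, ∀ z ∈ Dset M A xb, ‖z - xb‖ = r →
          f xb + c ≤ f z := by
        intro r hr
        by_contra! hcon
        have hcon' : ∀ n : ℕ, ∃ z ∈ Dset M A xb, ‖z - xb‖ = r ∧ f z < f xb + 1 / ((n : ℝ) + 1) :=
          fun n => hcon _ (by positivity)
        choose u hu1 hu2 hu3 using hcon'
        have ht : Tendsto (fun k => f (u k)) atTop (𝓝 (f xb)) := by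
          have h6 := (tendsto_one_div_add_atTop_nhds_zero_nat (𝕜 := ℝ)).const_add (f xb)
          rw [add_zero] at h6
          exact tendsto_of_tendsto_of_tendsto_of_le_of_le tendsto_const_nhds h6
            (fun k => hmin _ (hu1 k)) (fun k => (hu3 k).le)
        have h7 := hseq u hu1 ht
        have h8 : ∀ k, minTime M (u k) xb = ENNReal.ofReal r := by
          intro k
          rw [aux_minTime_eq M hMsph _ _ ((aux_mem_Dset M A _ _).1 (hu1 k)).2, norm_sub_rev, hu2]
        simp only [h8] at h7
        have := tendsto_nhds_unique h7 tendsto_const_nhds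
        simp at this
        linarith
      rw [ENNReal.tendsto_nhds_zero]
      intro δ hδ
      obtain ⟨r, hr, hrδ⟩ : ∃ r : ℝ, 0 < r ∧ 2 * ENNReal.ofReal r ≤ δ := by
        obtain ⟨q, hq0, hq⟩ := ENNReal.lt_iff_exists_nnreal_btwn.1 hδ
        refine ⟨(q : ℝ) / 2, by have : 0 < q := by exact_mod_cast hq0
                                positivity, ?_⟩
        have : (2 : ℝ≥0∞) = ENNReal.ofReal 2 := by simp
        rw [this, ← ENNReal.ofReal_mul (by norm_num), mul_div_cancel₀ _ (by norm_num)]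
        simpa using hq.le
      obtain ⟨c, hc, hgr⟩ := hgrow r hr
      filter_upwards [Ioo_mem_nhdsGT (show (0 : ℝ) < c / r by positivity)] with ε hε
      have hball : ∀ x ∈ {x ∈ Dset M A xb | ∀ y ∈ Dset M A xb,
              ((f' x (x - y) : ℝ) : EReal)
                ≤ ((ENNReal.ofReal ε * minTime M x y : ℝ≥0∞) : EReal)},
          x ∈ Metric.closedEBall xb (ENNReal.ofReal r) := by
        rintro x ⟨hx, hxH⟩
        have h1 := (aux_ineq M hMsph x xb _ ε hε.1).1 (hxH xb (hself xb hxb))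
          ((aux_mem_Dset M A _ _).1 hx).2
        have h2 := aux_grad_le A f hconv x xb (hDA _ hx) hxb (f' x) (hgat x (hDA _ hx))
        rw [norm_sub_rev] at h1
        rw [Metric.mem_closedEBall, edist_dist]
        apply ENNReal.ofReal_le_ofReal
        rw [dist_eq_norm]
        by_contra! hlt
        have hpos : 0 < ‖x - xb‖ := hr.trans hlt
        have ht0 : 0 < r / ‖x - xb‖ := by positivity
        have ht1 : r / ‖x - xb‖ ≤ 1 := (div_le_one hpos).2 hlt.le
        set t := r / ‖x - xb‖ with ht
        have htr : t * ‖x - xb‖ = r := div_mul_cancel₀ _ hpos.ne'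
        have hz := (hDconv xb).add_smul_sub_mem (hself xb hxb) hx ⟨ht0.le, ht1⟩
        have h3 := hgr _ hz (by
          rw [add_sub_cancel_left, norm_smul, Real.norm_of_nonneg ht0.le, htr])
        have h4 := hconv.2 hxb (hDA _ hx) (sub_nonneg.2 ht1) ht0.le (by ring)
        have e : (1 - t) • xb + t • x = xb + t • (x - xb) := by module
        rw [e] at h4
        simp only [smul_eq_mul] at h4
        have h5 : ε * r < c := (lt_div_iff₀ hr).1 hε.2
        have h6 : t * (f x - f xb) ≤ t * (ε * ‖x - xb‖) :=
          mul_le_mul_of_nonneg_left (h2.trans h1) ht0.le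
        have h7 : t * (ε * ‖x - xb‖) = ε * r := by rw [← htr]; ring
        linarith
      exact (Metric.ediam_mono hball).trans (Metric.ediam_closedEBall_le.trans hrδ)
  · rintro ⟨xb, hxb, -, hH, hdiam⟩
    have hmin : ∀ x ∈ Dset M A xb, f xb ≤ f x := by
      intro y hy
      have h1 : f' xb (xb - y) ≤ 0 := by
        refine le_of_forall_pos_le_add fun η hη => ?_
        have h2 := (aux_ineq M hMsph y xb _ (η / (‖xb - y‖ + 1)) (by positivity)).1
          ((hH (η / (‖xb - y‖ + 1)) (by positivity)).2 y hy) ((aux_mem_Dset M A _ _).1 hy).2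
        refine h2.trans ?_
        rw [zero_add, div_mul_eq_mul_div, div_le_iff₀ (by positivity)]
        nlinarith
      have h2 := aux_grad_le A f hconv xb y hxb (hDA _ hy) (f' xb) (hgat xb hxb)
      linarith
    -- approximate minimizers lie in H'
    have hmem : ∀ ε : ℝ, 0 < ε → ∀ x ∈ Dset M A xb,
        (∀ z ∈ Dset M A xb, f x ≤ f z + ε * ‖z - x‖) →
        x ∈ {x ∈ Dset M A xb | ∀ y ∈ Dset M A xb,
              ((f' x (x - y) : ℝ) : EReal)
                ≤ ((ENNReal.ofReal ε * minTime M x y : ℝ≥0∞) : EReal)} := by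
      intro ε hε x hx h
      refine ⟨hx, fun y hy => (aux_ineq M hMsph x y _ ε hε).2 fun _ => ?_⟩
      exact aux_grad_ge _ (hDconv xb) f x y hx hy ε h (f' x) (hgat x (hDA _ hx))
    have hsmall : ∀ η : ℝ, 0 < η → ∃ ε : ℝ, 0 < ε ∧ ε ≤ η ∧ ∀ x ∈ Dset M A xb,
        (∀ z ∈ Dset M A xb, f x ≤ f z + ε * ‖z - x‖) → dist x xb ≤ η := by
      intro η hη
      have h1 := (ENNReal.tendsto_nhds_zero.1 hdiam) (ENNReal.ofReal η) (by simpa using hη)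
      obtain ⟨ε, h2, h3⟩ := (h1.and (Ioo_mem_nhdsGT hη)).exists
      refine ⟨ε, h3.1, h3.2.le, fun x hx hx2 => ?_⟩
      have h4 := hmem ε h3.1 x hx hx2
      have h5 := hmem ε h3.1 xb (hself xb hxb) fun z hz =>
        (hmin z hz).trans (le_add_of_nonneg_right (mul_nonneg h3.1.le (norm_nonneg _)))
      have h6 := Metric.edist_le_of_ediam_le h4 h5 h2
      rw [edist_dist] at h6
      exact (ENNReal.ofReal_le_ofReal_iff hη.le).1 h6
    refine ⟨xb, hxb, hmin, ?_, ?_⟩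
    · intro x hx hfx
      refine dist_le_zero.1 (le_of_forall_pos_le_add fun η hη => ?_)
      obtain ⟨ε, hε, -, h⟩ := hsmall η hη
      rw [zero_add]
      refine h x hx fun z hz => ?_
      rw [hfx]
      exact (hmin z hz).trans (le_add_of_nonneg_right (mul_nonneg hε.le (norm_nonneg _)))
    · intro u hu hfu
      have hud : Tendsto u atTop (𝓝 xb) := by
        rw [Metric.tendsto_nhds]
        intro η hη
        obtain ⟨ε, hε, hεη, h⟩ := hsmall (η / 3) (by positivity)
        have hev : ∀ᶠ k in atTop, f (u k) < f xb + ε * (η / 3) :=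
          hfu.eventually (gt_mem_nhds (lt_add_of_pos_right _ (by positivity)))
        filter_upwards [hev] with k hk
        obtain ⟨v, hv, hv1, hv2⟩ := aux_ekeland (Dset M A xb) (hDcl xb) f
          (hlsc.mono (hDA xb)) (f xb) hmin ε hε (u k) (hu k)
        have h1 := h v hv fun z hz => by rw [← dist_eq_norm]; exact hv2 z hz
        have h2 : dist (u k) v < η / 3 := by
          have := hmin v hv
          exact lt_of_mul_lt_mul_left (show ε * dist (u k) v < ε * (η / 3) by linarith) hε.le
        have h3 := dist_triangle (u k) v xb
        linarith
      have h8 : ∀ k, minTime M (u k) xb = ENNReal.ofReal (dist (u k) xb) := by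
        intro k
        rw [aux_minTime_eq M hMsph _ _ ((aux_mem_Dset M A _ _).1 (hu k)).2, norm_sub_rev,
          dist_eq_norm]
      simp only [h8]
      have := ENNReal.tendsto_ofReal (tendsto_iff_dist_tendsto_zero.1 hud)
      simpa using this
end

section
/- Define c₀(t) := inf{f(x) − f(x̄) : x ∈ D_x̄, T_M(x, x̄) = t} for t ≥ 0 (with inf ∅ = +∞). For every t₀ > 0 and every s₀ ∈ [0, t₀], one has c₀(s₀) ≤ (s₀/t₀)·c₀(t₀). -/
open Filter Topology Set
open scoped ENNReal

variable {X : Type*} [NormedAddCommGroup X] [NormedSpace ℝ X]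

/-- `c₀(t) = inf {f(x) − f(x̄) | x ∈ D_x̄, T_M(x,x̄) = t}`, with `inf ∅ = +∞`. -/
noncomputable def cZero (M A : Set X) (f : X → EReal) (xb : X) (t : ℝ) : EReal :=
  sInf {v : EReal | ∃ x ∈ Dset M A xb, minTime M x xb = ENNReal.ofReal t ∧ v = f x - f xb}

theorem minTime_eq_aux (M : Set X) (hM : M ⊆ Metric.sphere (0 : X) 1) (y x m : X) (r : ℝ)
    (hr : 0 ≤ r) (hm : m ∈ M) (h : x = y + r • m) : minTime M y x = ENNReal.ofReal r := by
  unfold minTime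
  apply le_antisymm
  · exact sInf_le ⟨r, hr, rfl, m, hm, h⟩
  · apply le_sInf
    rintro t ⟨r', hr', rfl, m', hm', h'⟩
    have h1 : r • m = r' • m' := add_left_cancel (h.symm.trans h')
    have h2 := congrArg norm h1
    have n1 : ‖m‖ = 1 := by simpa using hM hm
    have n2 : ‖m'‖ = 1 := by simpa using hM hm'
    rw [norm_smul, norm_smul, n1, n2, Real.norm_of_nonneg hr, Real.norm_of_nonneg hr'] at h2
    apply ENNReal.ofReal_le_ofReal
    linarith

theorem minTime_ex_aux (M : Set X) (y x : X) (h : minTime M y x ≠ ⊤) :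
    ∃ r : ℝ, 0 ≤ r ∧ ∃ m ∈ M, x = y + r • m := by
  by_contra hc
  apply h
  unfold minTime
  rw [sInf_eq_top]
  rintro t ⟨r, hr, _, hm⟩
  exact absurd ⟨r, hr, hm⟩ hc

/-- Proposition 4.1: for `t₀ > 0` and `s₀ ∈ [0,t₀]`,
`c₀(s₀) ≤ (s₀/t₀)·c₀(t₀)`. -/
theorem cZero_scaling [CompleteSpace X]
    (M : Set X) (hMne : M.Nonempty) (hMcl : IsClosed M)
    (hMsph : M ⊆ Metric.sphere (0 : X) 1) (hMcone : Convex ℝ (coneOf M))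
    (A : Set X) (hAne : A.Nonempty) (hAcl : IsClosed A) (hAconv : Convex ℝ A)
    (f : X → EReal) (hbot : ∀ x, f x ≠ ⊥)
    (xb : X) (hxb : xb ∈ A) (hfxb : f xb ≠ ⊤)
    (hmin : ∀ x ∈ Dset M A xb, f xb ≤ f x)
    (hsub : ∀ x ∈ Dset M A xb, ∀ s : ℝ, 0 ≤ s → s ≤ 1 →
      f (s • x + (1 - s) • xb) ≤ (s : EReal) * f x + ((1 - s : ℝ) : EReal) * f xb)
    (t0 s0 : ℝ) (ht0 : 0 < t0) (hs0 : s0 ∈ Icc (0 : ℝ) t0) :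
    cZero M A f xb s0 ≤ ((s0 / t0 : ℝ) : EReal) * cZero M A f xb t0 := by
  obtain ⟨h0, h1⟩ := hs0
  obtain ⟨b, hb⟩ : ∃ b : ℝ, f xb = (b : EReal) :=
    ⟨(f xb).toReal, (EReal.coe_toReal hfxb (hbot xb)).symm⟩
  rcases h0.eq_or_lt with h0 | h0
  · subst h0
    obtain ⟨m, hm⟩ := hMne
    have hT := minTime_eq_aux M hMsph xb xb m 0 le_rfl hm (by simp)
    simp only [zero_div, EReal.coe_zero, zero_mul]
    refine sInf_le ⟨xb, ⟨hxb, ?_⟩, hT, ?_⟩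
    · simp [hT]
    · rw [hb, ← EReal.coe_sub, sub_self, EReal.coe_zero]
  · obtain ⟨s, hs⟩ : ∃ s : ℝ, s = s0 / t0 := ⟨_, rfl⟩
    have hspos : 0 < s := by rw [hs]; positivity
    have hs1 : s ≤ 1 := by rw [hs]; exact (div_le_one ht0).2 h1
    rw [← hs]
    have key : ((s⁻¹ : ℝ) : EReal) * cZero M A f xb s0 ≤ cZero M A f xb t0 := by
      apply le_sInf
      rintro v ⟨x, hx, hxt, rfl⟩
      by_cases htop : f x = ⊤
      · rw [htop, hb, EReal.top_sub_coe]; exact le_top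
      obtain ⟨a, ha⟩ : ∃ a : ℝ, f x = (a : EReal) :=
        ⟨(f x).toReal, (EReal.coe_toReal htop (hbot x)).symm⟩
      obtain ⟨r, hr, m, hm, hxm⟩ := minTime_ex_aux M x xb hx.2
      have hT := minTime_eq_aux M hMsph x xb m r hr hm hxm
      have hrt : r = t0 := (ENNReal.ofReal_eq_ofReal_iff hr ht0.le).1 (hT.symm.trans hxt)
      have hsr : s * r = s0 := by rw [hrt, hs]; field_simp
      have hT' : minTime M (s • x + (1 - s) • xb) xb = ENNReal.ofReal s0 := by
        apply minTime_eq_aux M hMsph _ _ m s0 h0.le hm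
        rw [← hsr, hxm]
        module
      have hle := hsub x hx s hspos.le hs1
      have hc : cZero M A f xb s0 ≤ f (s • x + (1 - s) • xb) - f xb := by
        refine sInf_le ⟨_, ⟨?_, ?_⟩, hT', rfl⟩
        · exact hAconv hx.1 hxb hspos.le (by linarith) (by ring)
        · simp [hT']
      have hc2 : cZero M A f xb s0 ≤ ((s * (a - b) : ℝ) : EReal) := by
        refine hc.trans ((EReal.sub_le_sub hle le_rfl).trans (le_of_eq ?_))
        rw [ha, hb]
        norm_cast
        ring
      calc ((s⁻¹ : ℝ) : EReal) * cZero M A f xb s0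
          ≤ ((s⁻¹ : ℝ) : EReal) * ((s * (a - b) : ℝ) : EReal) :=
            mul_le_mul_of_nonneg_left hc2 (by exact_mod_cast (inv_pos.2 hspos).le)
        _ = f x - f xb := by
            rw [ha, hb, ← EReal.coe_mul, ← EReal.coe_sub]
            congr 1
            field_simp
    calc cZero M A f xb s0 = (s : EReal) * (((s⁻¹ : ℝ) : EReal) * cZero M A f xb s0) := by
          rw [← mul_assoc, ← EReal.coe_mul, mul_inv_cancel₀ hspos.ne', EReal.coe_one, one_mul]
      _ ≤ _ := mul_le_mul_of_nonneg_left key (by exact_mod_cast hspos.le)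
end
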